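/- Let X = (X₁,…,X_M) be any random vector in ℝ^M. Then max_{1≤i≤M} P(X_i > b) ≤ P(max_{1≤i≤M} X_i > b) ≤ Σ_{j=1}^M P(X_j > b) for every b. If moreover X is a centered Gaussian vector with nonsingular covariance matrix, then P(max_{1≤i≤M} X_i > b) = (1+o(1)) Σ_{j=1}^M P(X_j > b) as b → ∞. -/

import Mathlib

open MeasureTheory ProbabilityTheory Filter

open scoped NNReal

/-- Bonferroni's lower bound for the probability of a finite union. -/
lemma sum_measureReal_le_measureReal_iUnion_add {Ω ι : Type*} [MeasurableSpace Ω] [Fintype ι]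
    [DecidableEq ι] (μ : Measure Ω) [IsFiniteMeasure μ] {A : ι → Set Ω}
    (hA : ∀ i, MeasurableSet (A i)) :
    ∑ j, μ.real (A j) ≤
      μ.real (⋃ i, A i) + ∑ j, ∑ i ∈ Finset.univ.erase j, μ.real (A i ∩ A j) := by
  let B : ι → Set Ω := fun j => A j \ ⋃ i ∈ Finset.univ.erase j, A i
  have hBm : ∀ j, MeasurableSet (B j) := fun j =>
    (hA j).diff (Finset.measurableSet_biUnion _ fun i _ => hA i)
  have hBd : Pairwise (Function.onFun Disjoint B) := by
    intro i j hij
    refine Set.disjoint_left.2 fun x hxi hxj => hxj.2 ?_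
    exact Set.mem_biUnion (Finset.mem_coe.2 (Finset.mem_erase.2 ⟨hij, Finset.mem_univ i⟩)) hxi.1
  have hBA : ∑ j, μ.real (B j) ≤ μ.real (⋃ i, A i) := by
    rw [← measureReal_iUnion_fintype hBd hBm]
    exact measureReal_mono (Set.iUnion_mono fun i => Set.sdiff_subset)
  have hAB : ∀ j, μ.real (A j) ≤ μ.real (B j) + ∑ i ∈ Finset.univ.erase j, μ.real (A i ∩ A j) := by
    intro j
    have hsub : A j ⊆ B j ∪ ⋃ i ∈ Finset.univ.erase j, A i ∩ A j := by
      intro x hx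
      by_cases h : x ∈ ⋃ i ∈ Finset.univ.erase j, A i
      · right
        simp only [Set.mem_iUnion] at h ⊢
        obtain ⟨i, hi, hxi⟩ := h
        exact ⟨i, hi, hxi, hx⟩
      · exact Or.inl ⟨hx, h⟩
    calc μ.real (A j) ≤ μ.real (B j ∪ ⋃ i ∈ Finset.univ.erase j, A i ∩ A j) :=
          measureReal_mono hsub
      _ ≤ μ.real (B j) + μ.real (⋃ i ∈ Finset.univ.erase j, A i ∩ A j) :=
          measureReal_union_le _ _
      _ ≤ _ := by gcongr; exact measureReal_biUnion_finset_le _ _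
  calc ∑ j, μ.real (A j)
      ≤ ∑ j, (μ.real (B j) + ∑ i ∈ Finset.univ.erase j, μ.real (A i ∩ A j)) :=
        Finset.sum_le_sum fun j _ => hAB j
    _ ≤ _ := by rw [Finset.sum_add_distrib]; gcongr

/-- If the pairwise intersections are asymptotically negligible, the probability of a finite union
is equivalent to the sum of the probabilities. -/
lemma tendsto_measureReal_iUnion_div_sum {Ω ι β : Type*} [MeasurableSpace Ω] [Fintype ι]
    (μ : Measure Ω) [IsFiniteMeasure μ] {l : Filter β} {A : ι → β → Set Ω}
    (hA : ∀ i b, MeasurableSet (A i b)) (hpos : ∀ᶠ b in l, 0 < ∑ j, μ.real (A j b))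
    (hinter : ∀ i j, i ≠ j →
      (fun b => μ.real (A i b ∩ A j b)) =o[l] fun b => ∑ k, μ.real (A k b)) :
    Tendsto (fun b => μ.real (⋃ i, A i b) / ∑ j, μ.real (A j b)) l (nhds 1) := by
  classical
  have hsum : (fun b => ∑ j, ∑ i ∈ Finset.univ.erase j, μ.real (A i b ∩ A j b)) =o[l]
      fun b => ∑ k, μ.real (A k b) :=
    Asymptotics.IsLittleO.fun_sum fun j _ => Asymptotics.IsLittleO.fun_sum fun i hi =>
      hinter i j (Finset.ne_of_mem_erase hi)
  have hlow : Tendsto (fun b => 1 - (∑ j, ∑ i ∈ Finset.univ.erase j, μ.real (A i b ∩ A j b)) /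
      ∑ k, μ.real (A k b)) l (nhds 1) := by
    simpa using tendsto_const_nhds.sub hsum.tendsto_div_nhds_zero
  refine tendsto_of_tendsto_of_tendsto_of_le_of_le' hlow tendsto_const_nhds ?_ ?_
  · filter_upwards [hpos] with b hb
    rw [le_div_iff₀ hb, sub_mul, div_mul_cancel₀ _ hb.ne', one_mul, sub_le_iff_le_add]
    exact sum_measureReal_le_measureReal_iUnion_add μ fun i => hA i b
  · filter_upwards [hpos] with b hb
    rw [div_le_one hb]
    exact measureReal_iUnion_fintype_le _

lemma gaussianReal_real_Ioi_le {v : ℝ≥0} {u : ℝ} (hu : 0 < u) (hvu : v ≤ u) {b : ℝ}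
    (hb : 0 ≤ b) : (gaussianReal 0 v).real (Set.Ioi b) ≤ Real.exp (-b ^ 2 / (2 * u)) := by
  have h := measure_ge_le_exp_mul_mgf (μ := gaussianReal 0 v) (X := id) b
    (div_nonneg hb hu.le) (integrable_exp_mul_gaussianReal (b / u))
  rw [mgf_id_gaussianReal, ← Real.exp_add] at h
  refine (measureReal_mono fun x (hx : b < x) => hx.le).trans (h.trans (Real.exp_le_exp.2 ?_))
  have h1 : (v : ℝ) * (b / u) ^ 2 / 2 ≤ u * (b / u) ^ 2 / 2 := by gcongr
  have h2 : -(b / u) * b + u * (b / u) ^ 2 / 2 = -b ^ 2 / (2 * u) := by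
    field_simp
    ring
  linarith

lemma le_gaussianReal_real_Ioi {w : ℝ≥0} (hw : w ≠ 0) {b : ℝ} (hb : 0 ≤ b) :
    (√(2 * Real.pi * w))⁻¹ * Real.exp (-(b + 1) ^ 2 / (2 * w)) ≤
      (gaussianReal 0 w).real (Set.Ioi b) := by
  have hIoc : (gaussianReal 0 w).real (Set.Ioc b (b + 1)) =
      ∫ x in Set.Ioc b (b + 1), gaussianPDFReal 0 w x := by
    rw [measureReal_def, gaussianReal_apply_eq_integral 0 hw,
      ENNReal.toReal_ofReal (integral_nonneg fun x => gaussianPDFReal_nonneg _ _ _)]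
  refine le_trans ?_ (measureReal_mono (Set.Ioc_subset_Ioi_self : Set.Ioc b (b + 1) ⊆ _))
  rw [hIoc]
  calc (√(2 * Real.pi * w))⁻¹ * Real.exp (-(b + 1) ^ 2 / (2 * w))
      = ∫ _ in Set.Ioc b (b + 1), (√(2 * Real.pi * w))⁻¹ * Real.exp (-(b + 1) ^ 2 / (2 * w)) := by
        simp
    _ ≤ _ := by
        refine setIntegral_mono_on (integrable_const _) (integrable_gaussianPDFReal _ _).integrableOn
          measurableSet_Ioc fun x hx => ?_
        rw [gaussianPDFReal, sub_zero]
        have hx0 : 0 ≤ x := hb.trans hx.1.le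
        gcongr
        exact hx.2

lemma gaussianReal_real_Ioi_pos {w : ℝ≥0} (hw : w ≠ 0) {b : ℝ} (hb : 0 ≤ b) :
    0 < (gaussianReal 0 w).real (Set.Ioi b) :=
  lt_of_lt_of_le (by positivity) (le_gaussianReal_real_Ioi hw hb)

/-- The tail of a centered Gaussian is negligible compared to that of one with larger variance. -/
lemma isLittleO_gaussianReal_real_Ioi {v w : ℝ≥0} (hvw : v < w) :
    (fun b => (gaussianReal 0 v).real (Set.Ioi b)) =o[atTop]
      fun b => (gaussianReal 0 w).real (Set.Ioi b) := by
  have hw : 0 < w := (zero_le (a := v)).trans_lt hvw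
  have hw' : (0 : ℝ) < w := hw
  have hvw' : (v : ℝ) < w := hvw
  obtain ⟨u, hvu, huw⟩ := exists_between hvw'
  have hu : 0 < u := v.coe_nonneg.trans_lt hvu
  have hupper : (fun b => (gaussianReal 0 v).real (Set.Ioi b)) =O[atTop]
      fun b => Real.exp (-b ^ 2 / (2 * u)) := by
    refine Asymptotics.IsBigO.of_bound 1 ?_
    filter_upwards [eventually_ge_atTop 0] with b hb
    simpa [abs_of_nonneg measureReal_nonneg] using gaussianReal_real_Ioi_le hu hvu.le hb
  have hlower : (fun b : ℝ => Real.exp (-(b + 1) ^ 2 / (2 * w))) =O[atTop]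
      fun b => (gaussianReal 0 w).real (Set.Ioi b) := by
    refine Asymptotics.IsBigO.of_bound (√(2 * Real.pi * w)) ?_
    filter_upwards [eventually_ge_atTop 0] with b hb
    have h := le_gaussianReal_real_Ioi hw.ne' hb
    rw [inv_mul_le_iff₀ (by positivity)] at h
    simpa [abs_of_nonneg measureReal_nonneg] using h
  refine hupper.trans_isLittleO (Asymptotics.IsLittleO.trans_isBigO ?_ hlower)
  rw [Real.isLittleO_exp_comp_exp_comp]
  have ha : 0 < 1 / (2 * u) - 1 / (2 * w) := by
    rw [sub_pos]
    gcongr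
  have hlin : Tendsto (fun b : ℝ => (1 / (2 * u) - 1 / (2 * w)) * b + -(1 / w)) atTop atTop :=
    tendsto_atTop_add_const_right _ _ (tendsto_id.const_mul_atTop ha)
  refine (tendsto_atTop_add_const_right _ (-(1 / (2 * w : ℝ)))
    (hlin.atTop_mul_atTop₀ tendsto_id)).congr fun b => ?_
  simp only [id]
  field_simp
  ring

/-- For two square-integrable variables, the mean has second moment smaller than that of one
of them, unless their difference is degenerate. -/
lemma integral_half_add_sq_lt_max {Ω : Type*} [MeasurableSpace Ω] {μ : Measure Ω} {f g : Ω → ℝ}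
    (hf : MemLp f 2 μ) (hg : MemLp g 2 μ) (hfg : 0 < ∫ ω, (f ω - g ω) ^ 2 ∂μ) :
    ∫ ω, (1 / 2 * f ω + 1 / 2 * g ω) ^ 2 ∂μ < max (∫ ω, f ω ^ 2 ∂μ) (∫ ω, g ω ^ 2 ∂μ) := by
  have hpar : ∫ ω, (1 / 2 * f ω + 1 / 2 * g ω) ^ 2 ∂μ =
      1 / 2 * ∫ ω, f ω ^ 2 ∂μ + 1 / 2 * ∫ ω, g ω ^ 2 ∂μ
        - 1 / 4 * ∫ ω, (f ω - g ω) ^ 2 ∂μ := by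
    have h1 := hf.integrable_sq.const_mul (1 / 2)
    have h2 := hg.integrable_sq.const_mul (1 / 2)
    have h3 := (hf.sub hg).integrable_sq.const_mul (1 / 4)
    have h12 : Integrable (fun ω => 1 / 2 * f ω ^ 2 + 1 / 2 * g ω ^ 2) μ := h1.add h2
    simp only [Pi.sub_apply] at h3
    rw [← integral_const_mul, ← integral_const_mul, ← integral_const_mul,
      ← integral_add h1 h2, ← integral_sub h12 h3]
    congr 1 with ω
    ring
  have h1 := le_max_left (∫ ω, f ω ^ 2 ∂μ) (∫ ω, g ω ^ 2 ∂μ)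
  have h2 := le_max_right (∫ ω, f ω ^ 2 ∂μ) (∫ ω, g ω ^ 2 ∂μ)
  linarith

lemma ProbabilityTheory.HasLaw.integral_sq_of_gaussianReal {Ω : Type*} [MeasurableSpace Ω]
    {μ : Measure Ω} {Y : Ω → ℝ} {v : ℝ≥0} (hY : HasLaw Y (gaussianReal 0 v) μ) :
    ∫ ω, Y ω ^ 2 ∂μ = v := by
  have h := variance_of_integral_eq_zero (μ := gaussianReal 0 v) (X := id) aemeasurable_id
    (by simp)
  rw [variance_id_gaussianReal] at h
  rw [h, ← hY.map_eq, integral_map hY.aemeasurable (by fun_prop)]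
  rfl

lemma ProbabilityTheory.HasLaw.memLp_of_gaussianReal {Ω : Type*} [MeasurableSpace Ω]
    {μ : Measure Ω} {Y : Ω → ℝ} {m : ℝ} {v p : ℝ≥0} (hY : HasLaw Y (gaussianReal m v) μ) :
    MemLp Y p μ := by
  have h := memLp_id_gaussianReal (μ := m) (v := v) p
  rw [← hY.map_eq] at h
  exact h.comp_of_map hY.aemeasurable

lemma ProbabilityTheory.HasLaw.measureReal_lt {Ω : Type*} [MeasurableSpace Ω]
    {μ : Measure Ω} {Y : Ω → ℝ} {ν : Measure ℝ} (hY : HasLaw Y ν μ) (b : ℝ) :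
    μ.real {ω | b < Y ω} = ν.real (Set.Ioi b) := by
  rw [← hY.map_eq, map_measureReal_apply_of_aemeasurable hY.aemeasurable measurableSet_Ioi]
  rfl

/-- The second moment of `X i - X j` is positive when the second-moment matrix of `X` is
positive definite. -/
lemma integral_sub_sq_pos_of_posDef {Ω ι : Type*} [MeasurableSpace Ω] [Fintype ι] {μ : Measure Ω}
    {X : Ω → ι → ℝ} (hX : ∀ i, MemLp (fun ω => X ω i) 2 μ)
    (hpd : Matrix.PosDef (Matrix.of fun i j => ∫ ω, X ω i * X ω j ∂μ)) {i j : ι} (hij : i ≠ j) :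
    0 < ∫ ω, (X ω i - X ω j) ^ 2 ∂μ := by
  classical
  have hne : (Pi.single i 1 - Pi.single j 1 : ι → ℝ) ≠ 0 := fun h => by
    simpa [hij] using congrFun h i
  have h := hpd.dotProduct_mulVec_pos hne
  have hmul : ∀ k l, Integrable (fun ω => X ω k * X ω l) μ := fun k l =>
    (hX k).integrable_mul (hX l)
  have hmul' : ∀ k l m n, Integrable (fun ω => X ω k * X ω l - X ω m * X ω n) μ :=
    fun k l m n => (hmul k l).sub (hmul m n)
  have hexp : ∫ ω, (X ω i - X ω j) ^ 2 ∂μ =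
      ((∫ ω, X ω i * X ω i ∂μ) - ∫ ω, X ω j * X ω i ∂μ)
        - ((∫ ω, X ω i * X ω j ∂μ) - ∫ ω, X ω j * X ω j ∂μ) := by
    rw [← integral_sub (hmul _ _) (hmul _ _), ← integral_sub (hmul _ _) (hmul _ _),
      ← integral_sub (hmul' _ _ _ _) (hmul' _ _ _ _)]
    congr 1 with ω
    ring
  rw [hexp]
  simpa [Matrix.mulVec_sub, sub_dotProduct] using h

/-- Joint exceedances of a centered Gaussian pair are negligible with respect to the marginal
exceedances. -/
lemma isLittleO_measureReal_inter_of_gaussian {Ω ι : Type*} [MeasurableSpace Ω] [Fintype ι]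
    {μ : Measure Ω} [IsProbabilityMeasure μ] {X : Ω → ι → ℝ} {v : ι → ℝ≥0}
    (hlaw : ∀ i, HasLaw (fun ω => X ω i) (gaussianReal 0 (v i)) μ) {i j : ι} {u : ℝ≥0}
    (hmean : HasLaw (fun ω => 1 / 2 * X ω i + 1 / 2 * X ω j) (gaussianReal 0 u) μ)
    (hij : 0 < ∫ ω, (X ω i - X ω j) ^ 2 ∂μ) :
    (fun b => μ.real ({ω | b < X ω i} ∩ {ω | b < X ω j})) =o[atTop]
      fun b => ∑ k, μ.real {ω | b < X ω k} := by
  have hlt := integral_half_add_sq_lt_max (hlaw i).memLp_of_gaussianReal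
    (hlaw j).memLp_of_gaussianReal hij
  rw [hmean.integral_sq_of_gaussianReal, (hlaw i).integral_sq_of_gaussianReal,
    (hlaw j).integral_sq_of_gaussianReal] at hlt
  obtain ⟨k, hk⟩ : ∃ k, u < v k := by
    rcases lt_max_iff.1 hlt with h | h
    exacts [⟨i, h⟩, ⟨j, h⟩]
  have hmid : (fun b => μ.real ({ω | b < X ω i} ∩ {ω | b < X ω j})) =O[atTop]
      fun b => (gaussianReal 0 u).real (Set.Ioi b) := by
    refine Asymptotics.IsBigO.of_bound 1 (Eventually.of_forall fun b => ?_)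
    rw [Real.norm_of_nonneg measureReal_nonneg, Real.norm_of_nonneg measureReal_nonneg, one_mul,
      ← hmean.measureReal_lt]
    refine measureReal_mono fun ω hω => ?_
    obtain ⟨h1, h2⟩ := hω
    simp only [Set.mem_ofPred_eq] at h1 h2 ⊢
    linarith
  have hle : (fun b => (gaussianReal 0 (v k)).real (Set.Ioi b)) =O[atTop]
      fun b => ∑ k, μ.real {ω | b < X ω k} := by
    refine Asymptotics.IsBigO.of_bound 1 (Eventually.of_forall fun b => ?_)
    rw [Real.norm_of_nonneg measureReal_nonneg,
      Real.norm_of_nonneg (Finset.sum_nonneg fun _ _ => measureReal_nonneg), one_mul,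
      ← (hlaw k).measureReal_lt]
    exact Finset.single_le_sum (f := fun k => μ.real {ω | b < X ω k})
      (fun _ _ => measureReal_nonneg) (Finset.mem_univ k)
  exact (hmid.trans_isLittleO (isLittleO_gaussianReal_real_Ioi hk)).trans_isBigO hle

/-- For any random vector `X = (X₁, …, X_M)` in `ℝ^M`,
`max_i P(X_i > b) ≤ P(max_i X_i > b) ≤ ∑_j P(X_j > b)` for every `b`; and if `X` is a
centered Gaussian vector with nonsingular (positive definite) covariance matrix then
`P(max_i X_i > b) = (1 + o(1)) ∑_j P(X_j > b)` as `b → ∞`. -/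
theorem max_tail_bounds_and_gaussian_asymptotics
    {Ω : Type} [MeasureSpace Ω] [IsProbabilityMeasure (ℙ : Measure Ω)]
    {M : ℕ} (hM : 0 < M)
    (X : Ω → Fin M → ℝ) (hX : Measurable X) :
    (∀ b : ℝ,
      (⨆ i : Fin M, (ℙ {ω | X ω i > b}).toReal) ≤ (ℙ {ω | ∃ i, X ω i > b}).toReal ∧
        (ℙ {ω | ∃ i, X ω i > b}).toReal ≤ ∑ j : Fin M, (ℙ {ω | X ω j > b}).toReal) ∧
    -- Gaussian case: exact first-order asymptotics
    ((∀ c : Fin M → ℝ, ∃ v : NNReal,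
        Measure.map (fun ω => ∑ i, c i * X ω i) (ℙ : Measure Ω) = gaussianReal 0 v) →
      Matrix.PosDef (Matrix.of fun i j : Fin M => ∫ ω, X ω i * X ω j) →
      Tendsto
        (fun b : ℝ => (ℙ {ω | ∃ i, X ω i > b}).toReal /
          ∑ j : Fin M, (ℙ {ω | X ω j > b}).toReal)
        atTop (nhds 1)) := by
  have hunion : ∀ b : ℝ, {ω | ∃ i, X ω i > b} = ⋃ i, {ω | b < X ω i} := fun b => by
    ext ω
    simp
  have hXi : ∀ i, Measurable fun ω => X ω i := fun i => hX.eval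
  have : Nonempty (Fin M) := ⟨⟨0, hM⟩⟩
  refine ⟨fun b => ⟨?_, ?_⟩, fun hgauss hpd => ?_⟩
  · exact ciSup_le fun i => measureReal_mono fun ω hω => ⟨i, hω⟩
  · rw [hunion]
    exact measureReal_iUnion_fintype_le _
  have hcomb : ∀ c : Fin M → ℝ, ∃ v : ℝ≥0,
      HasLaw (fun ω => ∑ i, c i * X ω i) (gaussianReal 0 v) ℙ := fun c =>
    (hgauss c).imp fun v hv => ⟨by fun_prop, hv⟩
  have hlaw : ∀ i, ∃ v : ℝ≥0, HasLaw (fun ω => X ω i) (gaussianReal 0 v) ℙ := fun i => by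
    simpa [Pi.single_apply] using hcomb (Pi.single i 1)
  choose v hlaw using hlaw
  have hmean : ∀ i j, ∃ u : ℝ≥0,
      HasLaw (fun ω => 1 / 2 * X ω i + 1 / 2 * X ω j) (gaussianReal 0 u) ℙ := fun i j => by
    simpa [add_mul, Finset.sum_add_distrib, -one_div] using
      hcomb fun k => (if k = i then 1 / 2 else 0) + if k = j then 1 / 2 else 0
  have hv : ∀ i, v i ≠ 0 := fun i h => by
    have hdiag : 0 < ∫ ω, X ω i * X ω i := hpd.diag_pos (i := i)
    simp_rw [← sq, (hlaw i).integral_sq_of_gaussianReal, h] at hdiag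
    simp at hdiag
  simp_rw [hunion]
  refine tendsto_measureReal_iUnion_div_sum ℙ (A := fun i b => {ω | b < X ω i})
    (fun i b => measurableSet_lt measurable_const (hXi i)) ?_ fun i j hij => ?_
  · filter_upwards [eventually_ge_atTop 0] with b hb
    refine Finset.sum_pos (fun i _ => ?_) Finset.univ_nonempty
    rw [(hlaw i).measureReal_lt]
    exact gaussianReal_real_Ioi_pos (hv i) hb
  · obtain ⟨u, hu⟩ := hmean i j
    exact isLittleO_measureReal_inter_of_gaussian hlaw hu
      (integral_sub_sq_pos_of_posDef (fun k => (hlaw k).memLp_of_gaussianReal) hpd hij)
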